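/- Fix k ∈ N and set n = 2^k. If P ⊂ R^n is a lattice polytope in the class Q_k, then the Minkowski sum P + Δ^n_0 is not in Q_k, where Δ^n_0 = conv{0, e_1, ..., e_n} is the standard simplex; in fact Vol(P + Δ^n_0) is odd. -/

import Mathlib

open Pointwise MeasureTheory

noncomputable section

/-- Standard dot product on `Fin n → ℝ`. -/
def dotR {n : ℕ} (c x : Fin n → ℝ) : ℝ := ∑ i, c i * x i

/-- The set of minimizers of the linear functional `x ↦ cᵀx` over `P`. -/
def argminSet {n : ℕ} (c : Fin n → ℝ) (P : Set (Fin n → ℝ)) : Set (Fin n → ℝ) :=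
  {x ∈ P | ∀ y ∈ P, dotR c x ≤ dotR c y}

/-- A polytope: the convex hull of a nonempty finite set of points. -/
def IsPolytope {n : ℕ} (P : Set (Fin n → ℝ)) : Prop :=
  ∃ V : Finset (Fin n → ℝ), V.Nonempty ∧ P = convexHull ℝ (V : Set (Fin n → ℝ))

/-- A lattice polytope: the convex hull of a nonempty finite set of integral points. -/
def IsLatticePolytope {n : ℕ} (P : Set (Fin n → ℝ)) : Prop :=
  ∃ V : Finset (Fin n → ℤ), V.Nonempty ∧
    P = convexHull ℝ ((fun v (i : Fin n) => ((v i : ℤ) : ℝ)) '' (V : Set (Fin n → ℤ)))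

/-- `F` is a face of `P`: either the empty face or the set of minimizers of a
linear functional over `P`. -/
def IsFace {n : ℕ} (P F : Set (Fin n → ℝ)) : Prop :=
  F = ∅ ∨ ∃ c : Fin n → ℝ, F = argminSet c P

/-- The dimension of a set: the rank of the direction space of its affine span. -/
def polyDim {n : ℕ} (P : Set (Fin n → ℝ)) : ℕ :=
  Module.finrank ℝ (affineSpan ℝ P).direction

/-- A point all of whose coordinates are integers. -/
def IsIntPt {m : ℕ} (x : Fin m → ℝ) : Prop := ∀ i, ∃ z : ℤ, x i = (z : ℝ)

/-- An affine chart identifying the affine hull of `P` with `ℝ^r` and mapping the induced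
lattice of integral points bijectively onto `ℤ^r`. -/
def IsLatticeChart {n r : ℕ} (P : Set (Fin n → ℝ))
    (φ : (Fin n → ℝ) →ᵃ[ℝ] (Fin r → ℝ)) : Prop :=
  Set.BijOn (fun x => φ x) (affineSpan ℝ P : Set (Fin n → ℝ)) Set.univ ∧
  ∀ x ∈ affineSpan ℝ P, (IsIntPt x ↔ IsIntPt (φ x))

open Classical in
/-- The normalized volume of a (rational) polytope `P`: `r!` times the Euclidean volume of
the image of `P` under a lattice-preserving affine chart of its affine hull (`r = dim P`).
This is well defined (independent of the chart) and integral for lattice polytopes. -/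
def normVol {n : ℕ} (P : Set (Fin n → ℝ)) : ℝ :=
  (Nat.factorial (polyDim P)) *
    (if h : ∃ φ : (Fin n → ℝ) →ᵃ[ℝ] (Fin (polyDim P) → ℝ), IsLatticeChart P φ
      then (volume ((fun x => h.choose x) '' P)).toReal
      else 0)

/-- The normalized volume is an even integer. -/
def EvenVol {n : ℕ} (P : Set (Fin n → ℝ)) : Prop := ∃ m : ℤ, normVol P = 2 * (m : ℝ)

/-- The class `Q_k`: lattice polytopes all of whose faces of dimension at least `2^k`
have even normalized volume. -/
def InQclass (k : ℕ) {n : ℕ} (P : Set (Fin n → ℝ)) : Prop :=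
  IsLatticePolytope P ∧ ∀ F, IsFace P F → 2 ^ k ≤ polyDim F → EvenVol F

/-- The classes `P_k` of lattice polytopes dual to `k`-hidden-layer integral ReLU networks:
`P_0` consists of single lattice points, and `P_{k+1}` consists of finite Minkowski sums of
convex hulls of unions of pairs of polytopes from `P_k`. -/
def InPclass {n : ℕ} : ℕ → Set (Fin n → ℝ) → Prop
  | 0, P => ∃ v : Fin n → ℤ, P = {fun i => ((v i : ℤ) : ℝ)}
  | k+1, P => ∃ (l : ℕ) (Q : Fin l → Set (Fin n → ℝ)), 0 < l ∧
      (∀ i, ∃ Q₁ Q₂ : Set (Fin n → ℝ), InPclass k Q₁ ∧ InPclass k Q₂ ∧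
        Q i = convexHull ℝ (Q₁ ∪ Q₂)) ∧
      P = ∑ i, Q i

/-- A (polyhedral) subdivision of `R`: a finite collection of polytopes covering `R`,
any two of which intersect in a common face. -/
def IsSubdivision {n : ℕ} (R : Set (Fin n → ℝ)) (𝒞 : Finset (Set (Fin n → ℝ))) : Prop :=
  (∀ C ∈ 𝒞, IsPolytope C) ∧
  (⋃ C ∈ 𝒞, C) = R ∧
  ∀ C ∈ 𝒞, ∀ D ∈ 𝒞, IsFace C (C ∩ D) ∧ IsFace D (C ∩ D)

/-- The standard simplex `Δ^n_0 = conv{0, e_1, …, e_n} ⊆ ℝ^n`. -/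
def stdSimplexPoly (n : ℕ) : Set (Fin n → ℝ) :=
  convexHull ℝ ({0} ∪ Set.range (fun i : Fin n => fun j => if j = i then (1 : ℝ) else 0))


def EP (f : ℕ → ℕ → ℝ) : Prop :=
  ∃ (F : MvPolynomial (Fin 2) ℝ) (c : ℕ), ∀ s t : ℕ, c ≤ s → c ≤ t →
    f s t = MvPolynomial.eval ![(s : ℝ), (t : ℝ)] F

lemma EP.add {f g : ℕ → ℕ → ℝ} (hf : EP f) (hg : EP g) : EP (fun s t => f s t + g s t) := by
  obtain ⟨F, c, hF⟩ := hf
  obtain ⟨G, d, hG⟩ := hg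
  refine ⟨F + G, max c d, fun s t hs ht => ?_⟩
  beta_reduce
  rw [map_add, hF s t (by omega) (by omega), hG s t (by omega) (by omega)]

lemma EP.sub {f g : ℕ → ℕ → ℝ} (hf : EP f) (hg : EP g) : EP (fun s t => f s t - g s t) := by
  obtain ⟨F, c, hF⟩ := hf
  obtain ⟨G, d, hG⟩ := hg
  refine ⟨F - G, max c d, fun s t hs ht => ?_⟩
  beta_reduce
  rw [map_sub, hF s t (by omega) (by omega), hG s t (by omega) (by omega)]

lemma EP.zero : EP (fun _ _ => 0) := ⟨0, 0, by simp⟩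

lemma EP.sum {ι : Type*} (S : Finset ι) (f : ι → ℕ → ℕ → ℝ) (h : ∀ i, EP (f i)) :
    EP (fun s t => ∑ i ∈ S, f i s t) := by
  classical
  induction S using Finset.induction_on with
  | empty => simpa using EP.zero
  | insert i S hi ih =>
    simp only [Finset.sum_insert hi]
    exact (h i).add ih

lemma EP.congr {f g : ℕ → ℕ → ℝ} (hf : EP f) (c : ℕ)
    (h : ∀ s t, c ≤ s → c ≤ t → g s t = f s t) : EP g := by
  obtain ⟨F, d, hF⟩ := hf
  refine ⟨F, max c d, fun s t hs ht => ?_⟩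
  rw [h s t (by omega) (by omega), hF s t (by omega) (by omega)]

lemma EP.shift {f : ℕ → ℕ → ℝ} (hf : EP f) (p q : ℕ) : EP (fun s t => f (s - p) (t - q)) := by
  obtain ⟨F, c, hF⟩ := hf
  refine ⟨MvPolynomial.bind₁ ![MvPolynomial.X 0 - MvPolynomial.C (p : ℝ),
    MvPolynomial.X 1 - MvPolynomial.C (q : ℝ)] F, c + p + q, fun s t hs ht => ?_⟩
  beta_reduce
  rw [hF _ _ (by omega) (by omega), ← MvPolynomial.coe_aeval_eq_eval,
    ← MvPolynomial.coe_aeval_eq_eval]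
  simp only [RingHom.coe_coe, MvPolynomial.aeval_bind₁]
  congr 2
  funext i
  fin_cases i
  · simp [Nat.cast_sub (show p ≤ s by omega)]
  · simp [Nat.cast_sub (show q ≤ t by omega)]

lemma EP.choose (a b : ℕ) :
    EP (fun s t => ((s + a).choose a : ℝ) * ((t + b).choose b : ℝ)) := by
  refine ⟨Polynomial.aeval (MvPolynomial.X 0) (Polynomial.preHilbertPoly ℝ a 0) *
    Polynomial.aeval (MvPolynomial.X 1) (Polynomial.preHilbertPoly ℝ b 0), 0, fun s t _ _ => ?_⟩
  have h1 := Polynomial.preHilbertPoly_eq_choose_sub_add ℝ a (k := 0) (n := s) (Nat.zero_le _)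
  have h2 := Polynomial.preHilbertPoly_eq_choose_sub_add ℝ b (k := 0) (n := t) (Nat.zero_le _)
  simp only [Nat.sub_zero] at h1 h2
  beta_reduce
  rw [← h1, ← h2, map_mul, ← MvPolynomial.coe_aeval_eq_eval]
  simp only [RingHom.coe_coe, ← Polynomial.aeval_algHom_apply, MvPolynomial.aeval_X]
  simp [Polynomial.aeval_def, Polynomial.eval₂_eq_eval_map]

abbrev ZZ (a b : ℕ) := (Fin (a+1) → ℕ) × (Fin (b+1) → ℕ)

def lev (a b s t : ℕ) : Set (ZZ a b) := {z | ∑ i, z.1 i = s ∧ ∑ i, z.2 i = t}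

lemma simplex_count (a s : ℕ) :
    ({x : Fin (a+1) → ℕ | ∑ i, x i = s}).Finite ∧
    ({x : Fin (a+1) → ℕ | ∑ i, x i = s}).ncard = (s + a).choose a := by
  have e : {x : Fin (a+1) → ℕ | ∑ i, x i = s} =
      ((Finset.univ.finsuppAntidiag s : Finset (Fin (a+1) →₀ ℕ)).map
        Finsupp.equivFunOnFinite.toEmbedding : Finset (Fin (a+1) → ℕ)) := by
    ext x
    simp only [Set.mem_ofPred_eq, Finset.coe_map, Set.mem_image, Finset.mem_coe,
      Finset.mem_finsuppAntidiag]
    constructor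
    · intro h
      exact ⟨Finsupp.equivFunOnFinite.symm x, ⟨by simpa using h, by simp⟩, by simp⟩
    · rintro ⟨y, ⟨h, _⟩, rfl⟩
      simpa using h
  rw [e]
  refine ⟨Finset.finite_toSet _, ?_⟩
  rw [Set.ncard_coe_finset, Finset.card_map, Finset.card_finsuppAntidiag_nat_eq_choose]
  simp only [Finset.card_univ, Fintype.card_fin]
  rw [show a + 1 + s - 1 = s + a by omega, Nat.choose_symm_add]

lemma lev_eq (a b s t : ℕ) : lev a b s t =
    {x : Fin (a+1) → ℕ | ∑ i, x i = s} ×ˢ {x : Fin (b+1) → ℕ | ∑ i, x i = t} := by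
  ext; simp [lev]

lemma lev_finite (a b s t : ℕ) : (lev a b s t).Finite := by
  rw [lev_eq]; exact (simplex_count a s).1.prod (simplex_count b t).1

lemma lev_card (a b s t : ℕ) : (lev a b s t).ncard = (s + a).choose a * (t + b).choose b := by
  rw [lev_eq, Set.ncard_prod, (simplex_count a s).2, (simplex_count b t).2]

def cnt {a b : ℕ} (U : Set (ZZ a b)) (s t : ℕ) : ℝ := ((U ∩ lev a b s t).ncard : ℝ)

lemma cnt_univ (a b : ℕ) : EP (cnt (Set.univ : Set (ZZ a b))) := by
  refine (EP.choose a b).congr 0 fun s t _ _ => ?_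
  simp [cnt, lev_card]

lemma cnt_Ici {a b : ℕ} (g : ZZ a b) : EP (cnt (Set.Ici g)) := by
  refine ((cnt_univ a b).shift (∑ i, g.1 i) (∑ i, g.2 i)).congr
    (∑ i, g.1 i + ∑ i, g.2 i) fun s t hs ht => ?_
  unfold cnt
  rw [Set.univ_inter]
  congr 1
  symm
  have : Set.Ici g ∩ lev a b s t =
      (fun z => z + g) '' lev a b (s - ∑ i, g.1 i) (t - ∑ i, g.2 i) := by
    ext z
    simp only [Set.mem_inter_iff, Set.mem_Ici, lev, Set.mem_ofPred_eq, Set.mem_image]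
    constructor
    · rintro ⟨h, h1, h2⟩
      obtain ⟨w, rfl⟩ := exists_add_of_le h
      refine ⟨w, ?_, add_comm _ _⟩
      simp only [Prod.fst_add, Prod.snd_add, Pi.add_apply, Finset.sum_add_distrib] at h1 h2
      omega
    · rintro ⟨w, ⟨h1, h2⟩, rfl⟩
      simp only [Prod.fst_add, Prod.snd_add, Pi.add_apply, Finset.sum_add_distrib]
      exact ⟨le_add_self, by omega, by omega⟩
  rw [this, Set.ncard_image_of_injective _ (add_left_injective g)]

lemma cnt_list {a b : ℕ} (l : ℕ) : ∀ L : List (ZZ a b), L.length = l →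
    EP (cnt {z | ∃ g ∈ L, g ≤ z}) := by
  induction l with
  | zero =>
    intro L hL
    rw [List.length_eq_zero_iff] at hL
    subst hL
    exact EP.zero.congr 0 (by simp [cnt])
  | succ l ih =>
    intro L hL
    match L, hL with
    | g :: L, hL =>
      have hL' : L.length = l := by simpa using hL
      have h1 := ih L hL'
      have h2 := ih (L.map (· ⊔ g)) (by simpa using hL')
      refine (((cnt_Ici g).add h1).sub h2).congr 0 fun s t _ _ => ?_
      have e1 : ({z | ∃ g' ∈ g :: L, g' ≤ z} ∩ lev a b s t) =
          (Set.Ici g ∩ lev a b s t) ∪ ({z | ∃ g' ∈ L, g' ≤ z} ∩ lev a b s t) := by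
        ext z; simp; tauto
      have e2 : ({z | ∃ g' ∈ L.map (· ⊔ g), g' ≤ z} ∩ lev a b s t) =
          (Set.Ici g ∩ lev a b s t) ∩ ({z | ∃ g' ∈ L, g' ≤ z} ∩ lev a b s t) := by
        ext z
        simp only [List.mem_map, Set.mem_inter_iff, Set.mem_ofPred_eq, Set.mem_Ici]
        constructor
        · rintro ⟨⟨_, ⟨g', hg', rfl⟩, h⟩, hz⟩
          exact ⟨⟨le_sup_right.trans h, hz⟩, ⟨g', hg', le_sup_left.trans h⟩, hz⟩
        · rintro ⟨⟨h, hz⟩, ⟨g', hg', h'⟩, _⟩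
          exact ⟨⟨_, ⟨g', hg', rfl⟩, sup_le h' h⟩, hz⟩
      unfold cnt
      rw [e1, e2]
      have := Set.ncard_union_add_ncard_inter (Set.Ici g ∩ lev a b s t)
        ({z | ∃ g' ∈ L, g' ≤ z} ∩ lev a b s t)
        ((lev_finite a b s t).inter_of_right _) ((lev_finite a b s t).inter_of_right _)
      have : (_ : ℝ) = _ := congrArg (Nat.cast (R := ℝ)) this
      push_cast at this
      linarith

lemma cnt_upper {a b : ℕ} (U : Set (ZZ a b)) (hU : IsUpperSet U) : EP (cnt U) := by
  have hfin : {z | Minimal (· ∈ U) z}.Finite :=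
    WellQuasiOrderedLE.finite_of_isAntichain (setOfPred_minimal_antichain _)
  have := cnt_list _ hfin.toFinset.toList rfl
  convert this using 2
  ext z
  simp only [Finset.mem_toList, Set.Finite.mem_toFinset, Set.mem_ofPred_eq]
  constructor
  · intro hz
    obtain ⟨g, hg, hm⟩ := exists_minimal_le_of_wellFoundedLT (· ∈ U) z hz
    exact ⟨g, hm, hg⟩
  · rintro ⟨g, hm, hg⟩
    exact hU hg hm.prop

lemma cnt_compl {a b : ℕ} (U : Set (ZZ a b)) (hU : IsUpperSet U) : EP (cnt Uᶜ) := by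
  refine ((cnt_univ a b).sub (cnt_upper U hU)).congr 0 fun s t _ _ => ?_
  unfold cnt
  have := Set.ncard_inter_add_ncard_sdiff_eq_ncard (lev a b s t) U (lev_finite a b s t)
  rw [Set.univ_inter, ← this, Set.inter_comm U, Set.inter_comm Uᶜ, ← Set.sdiff_eq]
  push_cast; ring

/-- multigraded Khovanskii/Hilbert. -/
theorem khov {H : Type*} [AddCommMonoid H] (a b q : ℕ) (v : Fin (a+1) → H) (w : Fin (b+1) → H)
    (pt : Fin q → H) (d e : Fin q → ℕ) :
    EP (fun s t => (({h : H | ∃ (r : Fin q) (z : ZZ a b),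
      h = pt r + ∑ i, z.1 i • v i + ∑ i, z.2 i • w i ∧
      d r + ∑ i, z.1 i = s ∧ e r + ∑ i, z.2 i = t}).ncard : ℝ)) := by
  classical
  let key : Fin q × ZZ a b → Lex (Lex (Fin (a+1) → ℕ) × Lex (Lex (Fin (b+1) → ℕ) × Fin q)) :=
    fun p => toLex (toLex p.2.1, toLex (toLex p.2.2, p.1))
  have key_inj : Function.Injective key := by
    rintro ⟨r, x, y⟩ ⟨r', x', y'⟩ h
    simp only [key, EmbeddingLike.apply_eq_iff_eq, Prod.mk.injEq] at h
    simp [h.1, h.2.1, h.2.2]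
  have key_add : ∀ (r r' : Fin q) (z z' u : ZZ a b), key (r, z) < key (r', z') →
      key (r, z + u) < key (r', z' + u) := by
    intro r r' z z' u h
    simp only [key, Prod.Lex.toLex_lt_toLex, Prod.fst_add, Prod.snd_add, toLex_add,
      add_lt_add_iff_right, add_left_inj] at h ⊢
    exact h
  let val : Fin q × ZZ a b → H × ℕ × ℕ := fun p =>
    (pt p.1 + ∑ i, p.2.1 i • v i + ∑ i, p.2.2 i • w i, d p.1 + ∑ i, p.2.1 i, e p.1 + ∑ i, p.2.2 i)
  have val_add : ∀ (r : Fin q) (z u : ZZ a b), val (r, z + u) = val (r, z) +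
      (∑ i, u.1 i • v i + ∑ i, u.2 i • w i, ∑ i, u.1 i, ∑ i, u.2 i) := by
    intro r z u
    simp only [val, Prod.fst_add, Prod.snd_add, Pi.add_apply, add_smul, Finset.sum_add_distrib,
      Prod.mk_add_mk, Prod.mk.injEq]
    refine ⟨by abel, by abel, by abel⟩
  let U : Fin q → Set (ZZ a b) := fun r =>
    {z | ∃ p : Fin q × ZZ a b, key p < key (r, z) ∧ val p = val (r, z)}
  have hU : ∀ r, IsUpperSet (U r) := by
    rintro r z z' hzz ⟨⟨r', y⟩, hk, hv⟩
    obtain ⟨u, rfl⟩ := exists_add_of_le hzz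
    exact ⟨(r', y + u), key_add _ _ _ _ _ hk, by rw [val_add, val_add, hv]⟩
  let c := ∑ r, (d r + e r)
  have hc : ∀ r, d r + e r ≤ c := fun r =>
    Finset.single_le_sum (f := fun r => d r + e r) (fun _ _ => Nat.zero_le _) (Finset.mem_univ r)
  refine (EP.sum Finset.univ (fun r s t => cnt (U r)ᶜ (s - d r) (t - e r))
    fun r => (cnt_compl _ (hU r)).shift _ _).congr c fun s t hs ht => ?_
  unfold cnt
  rw [← Nat.cast_sum]
  congr 1
  -- canonical representatives
  let E : Fin q → Finset (ZZ a b) := fun r =>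
    ((lev_finite a b (s - d r) (t - e r)).inter_of_right (U r)ᶜ).toFinset
  have hE : ∀ r z, z ∈ E r ↔ z ∉ U r ∧ d r + ∑ i, z.1 i = s ∧ e r + ∑ i, z.2 i = t := by
    intro r z
    have := hc r
    simp only [E, Set.Finite.mem_toFinset, Set.mem_inter_iff, Set.mem_compl_iff, lev,
      Set.mem_ofPred_eq]
    refine and_congr_right fun _ => and_congr ?_ ?_ <;> omega
  have e1 : ∑ r, ((U r)ᶜ ∩ lev a b (s - d r) (t - e r)).ncard =
      (Finset.univ.sigma E).card := by
    rw [Finset.card_sigma]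
    refine Finset.sum_congr rfl fun r _ => ?_
    rw [Set.ncard_eq_toFinset_card _ ((lev_finite a b (s - d r) (t - e r)).inter_of_right (U r)ᶜ)]
  rw [e1, ← Set.ncard_coe_finset]
  symm
  refine Set.ncard_congr (fun p _ => (val (p.1, p.2)).1) ?_ ?_ ?_
  · rintro ⟨r, z⟩ h
    simp only [Finset.coe_sigma, Set.mem_sigma_iff, Finset.mem_coe, hE] at h
    exact ⟨r, z, rfl, h.2.2.1, h.2.2.2⟩
  · rintro ⟨r, z⟩ ⟨r', z'⟩ h h' hv
    simp only [Finset.coe_sigma, Set.mem_sigma_iff, Finset.mem_coe, hE] at h h'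
    have hv' : val (r, z) = val (r', z') := by
      refine Prod.ext hv (Prod.ext ?_ ?_)
      · simp only [val]; rw [h.2.2.1, h'.2.2.1]
      · simp only [val]; rw [h.2.2.2, h'.2.2.2]
    have : key (r, z) = key (r', z') := by
      rcases lt_trichotomy (key (r, z)) (key (r', z')) with hlt | heq | hlt
      · exact absurd ⟨_, hlt, hv'⟩ h'.2.1
      · exact heq
      · exact absurd ⟨_, hlt, hv'.symm⟩ h.2.1
    have := key_inj this
    simp only [Prod.mk.injEq] at this
    obtain ⟨rfl, rfl⟩ := this
    rfl
  · rintro h ⟨r, z, rfl, h1, h2⟩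
    -- minimal element of the fibre
    let T : Finset (Fin q × ZZ a b) := (Finset.univ.biUnion fun r' : Fin q =>
      ((lev_finite a b (s - d r') (t - e r')).toFinset.image fun y => (r', y))).filter
        fun p => val p = val (r, z)
    have hT : ∀ p, p ∈ T ↔ val p = val (r, z) := by
      rintro ⟨r', y⟩
      simp only [T, Finset.mem_filter, Finset.mem_biUnion, Finset.mem_univ, true_and,
        Finset.mem_image, Set.Finite.mem_toFinset, and_iff_right_iff_imp]
      intro hv
      refine ⟨r', y, ?_, rfl⟩
      have hv1 := congrArg (fun x => x.2.1) hv
      have hv2 := congrArg (fun x => x.2.2) hv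
      simp only [val] at hv1 hv2
      simp only [lev, Set.mem_ofPred_eq]
      omega
    obtain ⟨⟨r', y⟩, hp, hmin⟩ := T.exists_min_image key ⟨(r, z), (hT _).2 rfl⟩
    rw [hT] at hp
    have hv1 := congrArg (fun x => x.2.1) hp
    have hv2 := congrArg (fun x => x.2.2) hp
    simp only [val] at hv1 hv2
    refine ⟨⟨r', y⟩, ?_, ?_⟩
    · simp only [Finset.coe_sigma, Set.mem_sigma_iff, Finset.mem_coe, hE, Finset.mem_univ, true_and]
      refine ⟨?_, by omega, by omega⟩
      rintro ⟨p, hk, hv⟩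
      exact absurd (hmin p ((hT p).2 (hv.trans hp))) (not_le.2 hk)
    · exact congrArg Prod.fst hp

def emb {n : ℕ} (x : Fin n → ℤ) : Fin n → ℝ := fun i => (x i : ℝ)

lemma emb_add {n : ℕ} (x y : Fin n → ℤ) : emb (x + y) = emb x + emb y := by
  funext i; simp [emb]

lemma emb_sub {n : ℕ} (x y : Fin n → ℤ) : emb (x - y) = emb x - emb y := by
  funext i; simp [emb]

lemma emb_inj {n : ℕ} : Function.Injective (emb (n := n)) := by
  intro x y h
  funext i
  have := congrFun h i
  simpa [emb] using this

lemma emb_sum {n : ℕ} {ι : Type*} [Fintype ι] (c : ι → ℕ) (v : ι → Fin n → ℤ) :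
    emb (∑ i, c i • v i) = ∑ i, (c i : ℝ) • emb (v i) := by
  funext j; simp [emb, Finset.sum_apply]

def latSet {n : ℕ} (S : Set (Fin n → ℝ)) : Set (Fin n → ℤ) := {x | emb x ∈ S}

def LC {n : ℕ} (S : Set (Fin n → ℝ)) : ℕ := (latSet S).ncard

lemma emb_range {n : ℕ} : (Set.range (emb (n := n))) =
    (Submodule.span ℤ (Set.range (Pi.basisFun ℝ (Fin n))) : Set (Fin n → ℝ)) := by
  ext x
  rw [SetLike.mem_coe, (Pi.basisFun ℝ (Fin n)).mem_span_iff_repr_mem ℤ]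
  constructor
  · rintro ⟨y, rfl⟩ i
    exact ⟨y i, by simp [emb]⟩
  · intro h
    choose y hy using h
    refine ⟨y, ?_⟩
    funext i
    have := hy i
    simpa [emb] using this

lemma latSet_finite {n : ℕ} {S : Set (Fin n → ℝ)} (hS : Bornology.IsBounded S) :
    (latSet S).Finite := by
  have h := ZSpan.setFinite_inter (Pi.basisFun ℝ (Fin n)) hS
  have : latSet S = emb ⁻¹' (S ∩ (Submodule.span ℤ (Set.range (Pi.basisFun ℝ (Fin n))) :
      Set (Fin n → ℝ))) := by
    rw [← emb_range]
    ext x; simp [latSet]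
  rw [this]
  exact h.preimage emb_inj.injOn

lemma LC_mono {n : ℕ} {S T : Set (Fin n → ℝ)} (hT : Bornology.IsBounded T) (h : S ⊆ T) :
    LC S ≤ LC T :=
  Set.ncard_le_ncard (fun _ hx => h hx) (latSet_finite hT)

lemma LC_tendsto {n : ℕ} {S : Set (Fin n → ℝ)} (h1 : Bornology.IsBounded S)
    (h2 : IsClosed S) (h3 : Convex ℝ S) :
    Filter.Tendsto (fun N : ℕ => (LC ((N : ℝ) • S) : ℝ) / (N : ℝ) ^ n) Filter.atTop
      (nhds (volume.real S)) := by
  have := tendsto_card_div_pow_atTop_volume S h1 h2.measurableSet (h3.addHaar_frontier volume)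
  simp only [Fintype.card_fin] at this
  refine this.congr' ?_
  filter_upwards [Filter.eventually_gt_atTop 0] with N hN
  have hN' : (N : ℝ) ≠ 0 := by positivity
  congr 2
  rw [← emb_range, Nat.card_coe_set_eq, LC]
  have : S ∩ (N : ℝ)⁻¹ • Set.range (emb (n := n)) =
      (fun x => (N : ℝ)⁻¹ • emb x) '' latSet ((N : ℝ) • S) := by
    ext y
    simp only [Set.mem_inter_iff, Set.mem_image, latSet, Set.mem_ofPred_eq]
    constructor
    · rintro ⟨hy, ⟨_, ⟨x, rfl⟩, rfl⟩⟩
      refine ⟨x, ?_, rfl⟩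
      rw [Set.mem_smul_set_iff_inv_smul_mem₀ hN']
      simpa using hy
    · rintro ⟨x, hx, rfl⟩
      rw [Set.mem_smul_set_iff_inv_smul_mem₀ hN'] at hx
      exact ⟨hx, Set.smul_mem_smul_set ⟨x, rfl⟩⟩
  rw [this, Set.ncard_image_of_injective]
  exact (smul_right_injective _ (inv_ne_zero hN')).comp emb_inj

lemma LC_mixed_tendsto {n : ℕ} {P Q : Set (Fin n → ℝ)} (hP : IsCompact P) (hPc : Convex ℝ P)
    (hQ : IsCompact Q) (q : Fin n → ℤ) (hq : emb q ∈ Q) (T : ℕ) :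
    Filter.Tendsto (fun N : ℕ => (LC ((N : ℝ) • P + (T : ℝ) • Q) : ℝ) / (N : ℝ) ^ n) Filter.atTop
      (nhds (volume.real P)) := by
  have hbd : ∀ N : ℕ, Bornology.IsBounded ((N : ℝ) • P + (T : ℝ) • Q) := fun N =>
    ((hP.smul (N : ℝ)).add (hQ.smul (T : ℝ))).isBounded
  rw [tendsto_order]
  constructor
  · intro a ha
    filter_upwards [(tendsto_order.1 (LC_tendsto hP.isBounded hP.isClosed hPc)).1 a ha] with N hN
    refine hN.trans_le ?_
    gcongr
    refine Set.ncard_le_ncard_of_injOn (fun x => x + T • q) ?_ (add_left_injective _).injOn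
      (latSet_finite (hbd N))
    intro x hx
    have : emb (x + T • q) = emb x + (T : ℝ) • emb q := by
      funext i; simp [emb]
    simp only [latSet, Set.mem_ofPred_eq, this] at hx ⊢
    exact Set.add_mem_add hx (Set.smul_mem_smul_set hq)
  · intro a ha
    have h0 : Filter.Tendsto (fun r => volume.real (Metric.cthickening r P)) (nhds 0)
        (nhds (volume.real P)) :=
      (ENNReal.tendsto_toReal hP.measure_lt_top.ne).comp (tendsto_measure_cthickening_of_isCompact hP)
    have h1 := (tendsto_order.1 h0).2 a ha
    obtain ⟨δ, hδ, hδ0⟩ : ∃ δ, volume.real (Metric.cthickening δ P) < a ∧ 0 < δ :=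
      ((h1.filter_mono nhdsWithin_le_nhds).and
        (self_mem_nhdsWithin : Set.Ioi (0:ℝ) ∈ nhdsWithin 0 (Set.Ioi 0))).exists
    obtain ⟨R, hR⟩ := hQ.isBounded.exists_norm_le
    have h2 : Filter.Tendsto (fun N : ℕ => (T : ℝ) * |R| / (N : ℝ)) Filter.atTop (nhds 0) :=
      tendsto_const_div_atTop_nhds_zero_nat _
    have hth := LC_tendsto (S := Metric.cthickening δ P) hP.isBounded.cthickening
      Metric.isClosed_cthickening (hPc.cthickening δ)
    filter_upwards [(tendsto_order.1 hth).2 a hδ, (tendsto_order.1 h2).2 δ hδ0,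
      Filter.eventually_gt_atTop 0] with N hN hN2 hN0
    have hN' : (0 : ℝ) < N := by exact_mod_cast hN0
    refine lt_of_le_of_lt ?_ hN
    gcongr
    refine LC_mono (hP.isBounded.cthickening.smul₀ _) ?_
    rintro _ ⟨_, ⟨x, hx, rfl⟩, _, ⟨y, hy, rfl⟩, rfl⟩
    rw [Set.mem_smul_set_iff_inv_smul_mem₀ hN'.ne']
    refine Metric.mem_cthickening_of_dist_le _ x δ P hx ?_
    have : (N : ℝ)⁻¹ • ((fun x => (N : ℝ) • x) x + (fun x => (T : ℝ) • x) y) - x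
        = ((T : ℝ) / N) • y := by
      simp only [smul_add, smul_smul, inv_mul_cancel₀ hN'.ne', one_smul, add_sub_cancel_left]
      congr 1; field_simp
    rw [dist_eq_norm, this, norm_smul, Real.norm_of_nonneg (by positivity)]
    refine le_trans ?_ hN2.le
    rw [mul_div_right_comm]
    gcongr
    exact (hR y hy).trans (le_abs_self R)

lemma poly_fd (p : Polynomial ℝ) (n : ℕ) (L : ℝ)
    (h : Filter.Tendsto (fun N : ℕ => p.eval (N : ℝ) / (N : ℝ) ^ n) Filter.atTop (nhds L)) (c : ℝ) :
    ∑ k ∈ Finset.range (n + 1), ((-1 : ℝ) ^ (n - k) * (n.choose k : ℝ)) * p.eval (c + k) =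
      n.factorial * L := by
  have key : (fwdDiff (1:ℝ))^[n] (fun x => p.eval x) c = n.factorial * L := by
    have hX : (Polynomial.X ^ n : Polynomial ℝ).degree = n := by simp
    rcases lt_trichotomy p.degree (Polynomial.X ^ n : Polynomial ℝ).degree with hlt | heq | hgt
    · have h1 := (Polynomial.div_tendsto_atTop_zero_of_degree_lt p _ hlt).comp
        tendsto_natCast_atTop_atTop
      simp only [Function.comp_def, Polynomial.eval_pow, Polynomial.eval_X] at h1
      rw [tendsto_nhds_unique h h1, mul_zero]
      by_cases hn : p = 0
      · subst hn
        rw [fwdDiff_iter_eq_sum_shift]; simp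
      · rw [hX] at hlt
        rw [Polynomial.fwdDiff_iter_eq_zero_of_degree_lt
          ((Polynomial.natDegree_lt_iff_degree_lt hn).2 hlt)]
        rfl
    · have h1 := (Polynomial.div_tendsto_atTop_leadingCoeff_div_of_degree_eq p _ heq).comp
        tendsto_natCast_atTop_atTop
      simp only [Function.comp_def, Polynomial.eval_pow, Polynomial.eval_X] at h1
      rw [tendsto_nhds_unique h h1]
      rw [hX] at heq
      have hd := Polynomial.natDegree_eq_of_degree_eq_some heq
      have := Polynomial.fwdDiff_iter_degree_eq_factorial p
      rw [hd] at this
      rw [this]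
      simp [mul_comm]
    · have h1 := (Polynomial.abs_div_tendsto_atTop_atTop_of_degree_gt p _ hgt (by simp)).comp
        tendsto_natCast_atTop_atTop
      simp only [Function.comp_def, Polynomial.eval_pow, Polynomial.eval_X] at h1
      exact absurd h.abs (not_tendsto_nhds_of_tendsto_atTop h1 _)
  rw [← key, fwdDiff_iter_eq_sum_shift]
  refine Finset.sum_congr rfl fun k _ => ?_
  simp

lemma parity_sum (m : ℕ) (h : ℕ → ℤ) :
    ∃ z : ℤ, ∑ k ∈ Finset.range (2 ^ m + 1), ((-1 : ℤ) ^ (2 ^ m - k) * ((2 ^ m).choose k : ℤ)) * h k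
      = h (2 ^ m) + h 0 + 2 * z := by
  obtain ⟨n, hn⟩ : ∃ n, 2 ^ m = n + 1 := ⟨2 ^ m - 1, by have := Nat.two_pow_pos m; omega⟩
  have hmid : (2 : ℤ) ∣ ∑ k ∈ Finset.range n,
      ((-1 : ℤ) ^ (2 ^ m - (k + 1)) * ((2 ^ m).choose (k + 1) : ℤ)) * h (k + 1) := by
    refine Finset.dvd_sum fun k hk => ?_
    have hk' := Finset.mem_range.1 hk
    have : 2 ∣ (2 ^ m).choose (k + 1) :=
      Nat.Prime.dvd_choose_pow Nat.prime_two (by omega) (by omega)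
    have : (2 : ℤ) ∣ ((2 ^ m).choose (k + 1) : ℤ) := by exact_mod_cast this
    exact (this.mul_left _).mul_right _
  obtain ⟨z, hz⟩ := hmid
  have hs : ∃ y : ℤ, (-1 : ℤ) ^ (2 ^ m) = 1 + 2 * y := by
    rcases neg_one_pow_eq_or ℤ (2 ^ m) with h | h
    · exact ⟨0, by rw [h]; rfl⟩
    · exact ⟨-1, by rw [h]; rfl⟩
  obtain ⟨y, hy⟩ := hs
  refine ⟨z + y * h 0, ?_⟩
  rw [Finset.sum_range_succ]
  conv_lhs => rw [show Finset.range (2 ^ m) = Finset.range (n + 1) by rw [hn]]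
  rw [Finset.sum_range_succ', hz]
  simp [hy]
  ring

lemma mem_hull_range {E : Type*} [AddCommGroup E] [Module ℝ E] {ι : Type*} [Fintype ι]
    (u : ι → E) (x : E) :
    x ∈ convexHull ℝ (Set.range u) ↔
      ∃ l : ι → ℝ, (∀ i, 0 ≤ l i) ∧ ∑ i, l i = 1 ∧ ∑ i, l i • u i = x := by
  classical
  have h1 : Set.range u = (Fintype.linearCombination ℝ u) ''
      (Set.range fun (i j : ι) => if i = j then (1 : ℝ) else 0) := by
    rw [← Set.range_comp]
    congr 1
    funext i
    simp [Fintype.linearCombination_apply]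
  rw [h1, ← LinearMap.image_convexHull, convexHull_basis_eq_stdSimplex]
  simp only [Set.mem_image, stdSimplex, Set.mem_ofPred_eq, Fintype.linearCombination_apply]
  simp only [and_assoc]

lemma mem_smul_hull {E : Type*} [AddCommGroup E] [Module ℝ E] {a : ℕ}
    (u : Fin (a+1) → E) (s : ℝ) (hs : 0 ≤ s) (x : E) :
    x ∈ s • convexHull ℝ (Set.range u) ↔
      ∃ l : Fin (a+1) → ℝ, (∀ i, 0 ≤ l i) ∧ ∑ i, l i = s ∧ ∑ i, l i • u i = x := by
  constructor
  · rintro ⟨y, hy, rfl⟩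
    obtain ⟨l, h0, h1, rfl⟩ := (mem_hull_range u y).1 hy
    refine ⟨fun i => s * l i, fun i => mul_nonneg hs (h0 i), ?_, ?_⟩
    · rw [← Finset.mul_sum, h1, mul_one]
    · simp [Finset.smul_sum, mul_smul]
  · rintro ⟨l, h0, h1, rfl⟩
    rcases hs.eq_or_lt with rfl | hs
    · have : ∀ i, l i = 0 := fun i =>
        (Finset.sum_eq_zero_iff_of_nonneg (fun i _ => h0 i)).1 h1 i (Finset.mem_univ i)
      refine ⟨u 0, subset_convexHull ℝ _ ⟨0, rfl⟩, ?_⟩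
      simp [this]
    · refine ⟨∑ i, (s⁻¹ * l i) • u i, (mem_hull_range u _).2 ⟨fun i => s⁻¹ * l i,
        fun i => mul_nonneg (inv_nonneg.2 hs.le) (h0 i), ?_, rfl⟩, ?_⟩
      · rw [← Finset.mul_sum, h1, inv_mul_cancel₀ hs.ne']
      · simp only [Finset.smul_sum, smul_smul, mul_inv_cancel_left₀ hs.ne']

lemma hull_compact {n a : ℕ} (v : Fin (a+1) → Fin n → ℤ) :
    IsCompact (convexHull ℝ (Set.range fun i => emb (v i))) :=
  (Set.finite_range _).isCompact_convexHull ℝ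

lemma floor_split {a s : ℕ} (l : Fin (a+1) → ℝ) (h0 : ∀ i, 0 ≤ l i) (h1 : ∑ i, l i = s) :
    ∃ s' : ℕ, s' ≤ a + 1 ∧ s' + ∑ i, ⌊l i⌋₊ = s ∧ ∑ i, (l i - ⌊l i⌋₊) = (s' : ℝ) := by
  have hle : ∑ i, ⌊l i⌋₊ ≤ s := by
    have : ((∑ i, ⌊l i⌋₊ : ℕ) : ℝ) ≤ s := by
      rw [← h1]; push_cast
      exact Finset.sum_le_sum fun i _ => Nat.floor_le (h0 i)
    exact_mod_cast this
  have hsum : ∑ i, (l i - ⌊l i⌋₊) = ((s - ∑ i, ⌊l i⌋₊ : ℕ) : ℝ) := by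
    rw [Nat.cast_sub hle, Finset.sum_sub_distrib, h1]; push_cast; rfl
  refine ⟨s - ∑ i, ⌊l i⌋₊, ?_, by omega, hsum⟩
  have : ((s - ∑ i, ⌊l i⌋₊ : ℕ) : ℝ) ≤ ((a + 1 : ℕ) : ℝ) := by
    rw [← hsum]
    calc ∑ i, (l i - ⌊l i⌋₊) ≤ ∑ i : Fin (a+1), (1 : ℝ) :=
          Finset.sum_le_sum fun i _ => by linarith [Nat.lt_floor_add_one (l i)]
      _ = _ := by simp
  exact_mod_cast this

lemma LC_EP {n a b : ℕ} (v : Fin (a+1) → Fin n → ℤ) (w : Fin (b+1) → Fin n → ℤ) :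
    EP (fun s t => (LC ((s : ℝ) • convexHull ℝ (Set.range fun i => emb (v i)) +
      (t : ℝ) • convexHull ℝ (Set.range fun i => emb (w i))) : ℝ)) := by
  set P := convexHull ℝ (Set.range fun i => emb (v i)) with hP
  set Q := convexHull ℝ (Set.range fun i => emb (w i)) with hQ
  have hmem : ∀ (s t : ℕ) (x : Fin n → ℝ), x ∈ (s : ℝ) • P + (t : ℝ) • Q ↔
      ∃ (l : Fin (a+1) → ℝ) (m : Fin (b+1) → ℝ), (∀ i, 0 ≤ l i) ∧ (∀ i, 0 ≤ m i) ∧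
        ∑ i, l i = s ∧ ∑ i, m i = t ∧ ∑ i, l i • emb (v i) + ∑ i, m i • emb (w i) = x := by
    intro s t x
    rw [Set.mem_add]
    constructor
    · rintro ⟨y, hy, z, hz, rfl⟩
      obtain ⟨l, h1, h2, rfl⟩ := (mem_smul_hull _ _ (Nat.cast_nonneg s) _).1 hy
      obtain ⟨m, h3, h4, rfl⟩ := (mem_smul_hull _ _ (Nat.cast_nonneg t) _).1 hz
      exact ⟨l, m, h1, h3, h2, h4, rfl⟩
    · rintro ⟨l, m, h1, h3, h2, h4, rfl⟩
      exact ⟨_, (mem_smul_hull _ _ (Nat.cast_nonneg s) _).2 ⟨l, h1, h2, rfl⟩, _,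
        (mem_smul_hull _ _ (Nat.cast_nonneg t) _).2 ⟨m, h3, h4, rfl⟩, rfl⟩
  let R : Set (ℕ × ℕ × (Fin n → ℤ)) := {p | p.1 ≤ a + 1 ∧ p.2.1 ≤ b + 1 ∧
    emb p.2.2 ∈ (p.1 : ℝ) • P + (p.2.1 : ℝ) • Q}
  have hR : R.Finite := by
    have : R ⊆ ⋃ s ∈ Finset.range (a+2), ⋃ t ∈ Finset.range (b+2),
        (fun x => (s, t, x)) '' latSet ((s : ℝ) • P + (t : ℝ) • Q) := by
      rintro ⟨s, t, x⟩ ⟨h1, h2, h3⟩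
      simp only [Set.mem_iUnion]
      exact ⟨s, by simp at *; omega, t, by simp at *; omega, x, h3, rfl⟩
    refine Set.Finite.subset ?_ this
    refine Set.Finite.biUnion (Finset.finite_toSet _) fun s _ =>
      Set.Finite.biUnion (Finset.finite_toSet _) fun t _ => Set.Finite.image _ (latSet_finite ?_)
    exact (((hull_compact v).smul (s : ℝ)).add ((hull_compact w).smul (t : ℝ))).isBounded
  have := hR.to_subtype
  obtain ⟨q, ⟨eq⟩⟩ := Finite.exists_equiv_fin R
  refine (khov a b q v w (fun r => (eq.symm r).1.2.2) (fun r => (eq.symm r).1.1)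
    (fun r => (eq.symm r).1.2.1)).congr 0 fun s t _ _ => ?_
  congr 1
  unfold LC
  congr 1
  ext x
  simp only [latSet, Set.mem_ofPred_eq, hmem]
  constructor
  · rintro ⟨l, m, hl, hm, hls, hmt, hx⟩
    obtain ⟨s', h1, h2, h3⟩ := floor_split l hl hls
    obtain ⟨t', h4, h5, h6⟩ := floor_split m hm hmt
    have hy : emb (x - ∑ i, ⌊l i⌋₊ • v i - ∑ i, ⌊m i⌋₊ • w i) ∈ (s' : ℝ) • P + (t' : ℝ) • Q := by
      rw [hmem]
      refine ⟨fun i => l i - ⌊l i⌋₊, fun i => m i - ⌊m i⌋₊,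
        fun i => sub_nonneg.2 (Nat.floor_le (hl i)), fun i => sub_nonneg.2 (Nat.floor_le (hm i)),
        h3, h6, ?_⟩
      rw [emb_sub, emb_sub, emb_sum, emb_sum, ← hx]
      simp only [sub_smul, Finset.sum_sub_distrib]
      abel
    refine ⟨eq ⟨(s', t', x - ∑ i, ⌊l i⌋₊ • v i - ∑ i, ⌊m i⌋₊ • w i), h1, h4, hy⟩,
      (fun i => ⌊l i⌋₊, fun i => ⌊m i⌋₊), ?_, ?_, ?_⟩
    · simp only [Equiv.symm_apply_apply]; abel
    · simpa using h2
    · simpa using h5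
  · rintro ⟨r, z, rfl, h1, h2⟩
    obtain ⟨-, -, h3⟩ := (eq.symm r).2
    rw [hmem] at h3
    obtain ⟨l, m, hl, hm, hls, hmt, hx⟩ := h3
    refine ⟨fun i => l i + z.1 i, fun i => m i + z.2 i, fun i => by have := hl i; positivity,
      fun i => by have := hm i; positivity, ?_, ?_, ?_⟩
    · rw [Finset.sum_add_distrib, hls, ← h1]; push_cast; rfl
    · rw [Finset.sum_add_distrib, hmt, ← h2]; push_cast; rfl
    · rw [emb_add, emb_add, emb_sum, emb_sum, ← hx]
      simp only [add_smul, Finset.sum_add_distrib]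
      abel

lemma restrict_poly (F : MvPolynomial (Fin 2) ℝ) (x y : Polynomial ℝ) (N : ℝ) :
    (MvPolynomial.aeval ![x, y] F).eval N = MvPolynomial.eval ![x.eval N, y.eval N] F := by
  rw [← Polynomial.coe_evalRingHom, MvPolynomial.aeval_def, MvPolynomial.hom_eval₂,
    MvPolynomial.eval, MvPolynomial.coe_eval₂Hom]
  congr 1
  · ext; simp
  · funext i; fin_cases i <;> simp

lemma fd_int (m : ℕ) (p : Polynomial ℝ) (L : ℝ) (c : ℕ) (h : ℕ → ℕ)
    (hp : ∀ N, c ≤ N → p.eval (N : ℝ) = h N)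
    (hlim : Filter.Tendsto (fun N : ℕ => (h N : ℝ) / (N : ℝ) ^ (2 ^ m)) Filter.atTop (nhds L)) :
    ∃ z : ℤ, ((2 ^ m).factorial : ℝ) * L = ((h (c + 2 ^ m) + h c + 2 * z : ℤ) : ℝ) := by
  have h1 : Filter.Tendsto (fun N : ℕ => p.eval (N : ℝ) / (N : ℝ) ^ (2 ^ m))
      Filter.atTop (nhds L) := by
    refine hlim.congr' ?_
    filter_upwards [Filter.eventually_ge_atTop c] with N hN
    rw [hp N hN]
  have h2 := poly_fd p _ L h1 c
  obtain ⟨z, hz⟩ := parity_sum m (fun k => (h (c + k) : ℤ))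
  refine ⟨z, ?_⟩
  rw [← h2]
  simp only [add_zero] at hz
  rw [← hz]
  push_cast
  refine Finset.sum_congr rfl fun k _ => ?_
  rw [← hp (c + k) (by omega)]
  push_cast
  rfl

theorem core (m a b : ℕ) (v : Fin (a+1) → Fin (2 ^ m) → ℤ) (w : Fin (b+1) → Fin (2 ^ m) → ℤ)
    (P Q : Set (Fin (2 ^ m) → ℝ)) (hP : P = convexHull ℝ (Set.range fun i => emb (v i)))
    (hQ : Q = convexHull ℝ (Set.range fun i => emb (w i))) :
    ∃ z1 z2 z3 y : ℤ, ((2 ^ m).factorial : ℝ) * volume.real (P + Q) = z1 ∧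
      ((2 ^ m).factorial : ℝ) * volume.real P = z2 ∧
      ((2 ^ m).factorial : ℝ) * volume.real Q = z3 ∧ z1 = z2 + z3 + 2 * y := by
  obtain ⟨F, c, hF⟩ := LC_EP v w
  rw [← hP, ← hQ] at hF
  beta_reduce at hF
  have hPc : IsCompact P := hP ▸ hull_compact v
  have hQc : IsCompact Q := hQ ▸ hull_compact w
  have hPx : Convex ℝ P := hP ▸ convex_convexHull ℝ _
  have hQx : Convex ℝ Q := hQ ▸ convex_convexHull ℝ _
  have hv : emb (v 0) ∈ P := hP ▸ subset_convexHull ℝ _ ⟨0, rfl⟩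
  have hw : emb (w 0) ∈ Q := hQ ▸ subset_convexHull ℝ _ ⟨0, rfl⟩
  obtain ⟨z1, h1⟩ := fd_int m (MvPolynomial.aeval ![Polynomial.X, Polynomial.X] F)
    (volume.real (P + Q)) c (fun N => LC ((N : ℝ) • P + (N : ℝ) • Q))
    (fun N hN => by
      rw [restrict_poly, hF N N hN hN]; simp)
    (by
      have := LC_tendsto (hPc.add hQc).isBounded (hPc.add hQc).isClosed (hPx.add hQx)
      simpa only [smul_add] using this)
  obtain ⟨z2, h2⟩ := fd_int m (MvPolynomial.aeval ![Polynomial.X,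
      Polynomial.C ((c + 2 ^ m : ℕ) : ℝ)] F)
    (volume.real P) c (fun N => LC ((N : ℝ) • P + ((c + 2 ^ m : ℕ) : ℝ) • Q))
    (fun N hN => by
      rw [restrict_poly, hF N _ hN (Nat.le_add_right _ _)]; simp)
    (LC_mixed_tendsto hPc hPx hQc _ hw _)
  obtain ⟨z3, h3⟩ := fd_int m (MvPolynomial.aeval ![Polynomial.C (c : ℝ), Polynomial.X] F)
    (volume.real Q) c (fun N => LC ((c : ℝ) • P + (N : ℝ) • Q))
    (fun N hN => by
      rw [restrict_poly, hF _ N le_rfl hN]; simp)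
    (by
      have := LC_mixed_tendsto hQc hQx hPc _ hv c
      simpa only [add_comm] using this)
  refine ⟨_, _, _, z1 - z2 - z3 - LC ((c : ℝ) • P + ((c + 2 ^ m : ℕ) : ℝ) • Q), h1, h2, h3, ?_⟩
  ring

lemma simplex_eq (n : ℕ) : stdSimplexPoly n = convexHull ℝ (Set.range fun i : Fin (n+1) =>
    emb ((Fin.cons 0 (fun i => Pi.single i 1) : Fin (n+1) → Fin n → ℤ) i)) := by
  unfold stdSimplexPoly
  congr 1
  have : (fun i : Fin (n+1) =>
    emb ((Fin.cons 0 (fun i => Pi.single i 1) : Fin (n+1) → Fin n → ℤ) i)) =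
    (Fin.cons 0 (fun i : Fin n => fun j => if j = i then (1 : ℝ) else 0) :
      Fin (n+1) → Fin n → ℝ) := by
    funext i
    refine Fin.cases ?_ (fun i => ?_) i
    · funext j; simp [emb]
    · funext j; simp [emb, Pi.single_apply]
  rw [this, Fin.range_cons]
  rfl

lemma mem_simplex_smul (n N : ℕ) (x : Fin n → ℤ) :
    emb x ∈ (N : ℝ) • stdSimplexPoly n ↔ (∀ i, 0 ≤ x i) ∧ ∑ i, x i ≤ N := by
  rw [simplex_eq, mem_smul_hull _ _ (Nat.cast_nonneg N)]
  have key : ∀ l : Fin (n+1) → ℝ, ∑ i, l i • emb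
      ((Fin.cons 0 (fun i => Pi.single i 1) : Fin (n+1) → Fin n → ℤ) i) =
      fun i => l i.succ := by
    intro l
    funext j
    rw [Fin.sum_univ_succ]
    simp [emb, Finset.sum_apply, Pi.single_apply]
  constructor
  · rintro ⟨l, hl, hs, hx⟩
    rw [key] at hx
    have hx' : ∀ i, l (Fin.succ i) = (x i : ℝ) := fun i => congrFun hx i
    rw [Fin.sum_univ_succ] at hs
    constructor
    · intro i
      have := hl i.succ
      rw [hx' i] at this
      exact_mod_cast this
    · have : (∑ i, (x i : ℝ)) ≤ N := by
        rw [← hs]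
        simp only [hx']
        linarith [hl 0]
      exact_mod_cast this
  · rintro ⟨h1, h2⟩
    refine ⟨Fin.cons ((N : ℝ) - ∑ i, (x i : ℝ)) (emb x), ?_, ?_, ?_⟩
    · intro i
      refine Fin.cases ?_ (fun i => ?_) i
      · simp only [Fin.cons_zero, sub_nonneg]; exact_mod_cast h2
      · simp only [Fin.cons_succ, emb]; exact_mod_cast h1 i
    · rw [Fin.sum_univ_succ]; simp [emb]
    · rw [key]; simp

lemma simplex_LC (n N : ℕ) : LC ((N : ℝ) • stdSimplexPoly n) = (N + n).choose n := by
  rw [← (simplex_count n N).2, LC]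
  symm
  refine Set.ncard_congr (fun x _ => fun i => ((x i.succ : ℕ) : ℤ)) ?_ ?_ ?_
  · intro x hx
    rw [Set.mem_ofPred_eq] at hx
    simp only [latSet, Set.mem_ofPred_eq, mem_simplex_smul]
    refine ⟨fun i => by positivity, ?_⟩
    rw [Fin.sum_univ_succ] at hx
    rw [← hx]; push_cast; simp
  · intro x y hx hy hxy
    rw [Set.mem_ofPred_eq, Fin.sum_univ_succ] at hx hy
    have h : ∀ i : Fin n, x i.succ = y i.succ := fun i => by
      have := congrFun hxy i
      exact_mod_cast this
    simp only [h] at hx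
    funext i
    refine Fin.cases ?_ (fun i => h i) i
    omega
  · intro y hy
    simp only [latSet, Set.mem_ofPred_eq, mem_simplex_smul] at hy
    obtain ⟨h1, h2⟩ := hy
    refine ⟨Fin.cons (N - (∑ i, (y i).toNat)) (fun i => (y i).toNat), ?_, ?_⟩
    · rw [Set.mem_ofPred_eq, Fin.sum_univ_succ]
      simp only [Fin.cons_zero, Fin.cons_succ]
      have : ∑ i, (y i).toNat ≤ N := by
        zify
        simpa [h1] using h2
      omega
    · funext i
      simp [h1 i]

lemma simplex_vol (n : ℕ) : (n.factorial : ℝ) * volume.real (stdSimplexPoly n) = 1 := by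
  have hc : IsCompact (stdSimplexPoly n) := by
    rw [simplex_eq]; exact hull_compact _
  have h1 := LC_tendsto hc.isBounded hc.isClosed (convex_convexHull ℝ _)
  have h2 : Filter.Tendsto (fun N : ℕ => (LC ((N : ℝ) • stdSimplexPoly n) : ℝ) / (N : ℝ) ^ n)
      Filter.atTop (nhds ((n.factorial : ℝ)⁻¹)) := by
    have := (Polynomial.div_tendsto_atTop_leadingCoeff_div_of_degree_eq
      (Polynomial.preHilbertPoly ℝ n 0) (Polynomial.X ^ n) (by
        rw [Polynomial.degree_X_pow, Polynomial.degree_eq_natDegree,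
          Polynomial.natDegree_preHilbertPoly]
        intro h
        have := Polynomial.leadingCoeff_preHilbertPoly ℝ n 0
        rw [h] at this
        simp at this
        exact Nat.factorial_ne_zero n (by exact_mod_cast this.symm))).comp tendsto_natCast_atTop_atTop
    rw [Polynomial.leadingCoeff_preHilbertPoly] at this
    simp only [Polynomial.leadingCoeff_X_pow, div_one] at this
    refine this.congr fun N => ?_
    simp only [Function.comp, Polynomial.eval_pow, Polynomial.eval_X]
    rw [simplex_LC, Polynomial.preHilbertPoly_eq_choose_sub_add ℝ n (Nat.zero_le N)]
    simp
  have := tendsto_nhds_unique h1 h2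
  unfold stdSimplexPoly at this ⊢
  rw [this]
  exact mul_inv_cancel₀ (by exact_mod_cast Nat.factorial_ne_zero _)

lemma latpoly_enum {n : ℕ} {P : Set (Fin n → ℝ)} (h : IsLatticePolytope P) :
    ∃ (a : ℕ) (v : Fin (a+1) → Fin n → ℤ),
      P = convexHull ℝ (Set.range fun i => emb (v i)) := by
  obtain ⟨V, hV, rfl⟩ := h
  obtain ⟨a, ha⟩ := Nat.exists_eq_add_one.2 hV.card_pos
  refine ⟨a, fun i => (V.equivFinOfCardEq ha).symm i, ?_⟩
  congr 1
  ext x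
  constructor
  · rintro ⟨v, hv, rfl⟩
    exact ⟨V.equivFinOfCardEq ha ⟨v, hv⟩, by simp; rfl⟩
  · rintro ⟨i, rfl⟩
    exact ⟨_, ((V.equivFinOfCardEq ha).symm i).2, rfl⟩

lemma chart_int_det {n : ℕ} (L : (Fin n → ℝ) →ₗ[ℝ] (Fin n → ℝ))
    (h : ∀ x, IsIntPt x → IsIntPt (L x)) : ∃ z : ℤ, LinearMap.det L = (z : ℝ) := by
  have : ∀ i j, ∃ z : ℤ, LinearMap.toMatrix' L i j = (z : ℝ) := by
    intro i j
    rw [LinearMap.toMatrix'_apply]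
    refine h _ ?_ i
    intro k
    by_cases hk : k = j
    · exact ⟨1, by simp [hk]⟩
    · exact ⟨0, by simp [hk]⟩
  choose A hA using this
  refine ⟨Matrix.det (Matrix.of A), ?_⟩
  rw [← LinearMap.det_toMatrix']
  have : LinearMap.toMatrix' L = (Matrix.of A).map (Int.castRingHom ℝ) := by
    ext i j; simp [hA]
  rw [this]
  exact (RingHom.map_det (Int.castRingHom ℝ) (Matrix.of A)).symm

lemma IsIntPt.sub' {n : ℕ} {x y : Fin n → ℝ} (hx : IsIntPt x) (hy : IsIntPt y) :
    IsIntPt (x - y) := by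
  intro i
  obtain ⟨a, ha⟩ := hx i
  obtain ⟨b, hb⟩ := hy i
  exact ⟨a - b, by simp [ha, hb]⟩

lemma IsIntPt.add' {n : ℕ} {x y : Fin n → ℝ} (hx : IsIntPt x) (hy : IsIntPt y) :
    IsIntPt (x + y) := by
  intro i
  obtain ⟨a, ha⟩ := hx i
  obtain ⟨b, hb⟩ := hy i
  exact ⟨a + b, by simp [ha, hb]⟩

lemma chart_vol {n : ℕ} {S : Set (Fin n → ℝ)} (hS : affineSpan ℝ S = ⊤)
    (φ : (Fin n → ℝ) →ᵃ[ℝ] (Fin n → ℝ)) (h : IsLatticeChart S φ) :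
    (volume ((fun x => φ x) '' S)).toReal = volume.real S := by
  obtain ⟨hb, hi⟩ := h
  rw [hS] at hb hi
  have hbij : Function.Bijective φ := by
    rw [← Set.bijOn_univ]; exact hb
  have hi' : ∀ x, IsIntPt x ↔ IsIntPt (φ x) := fun x => hi x trivial
  have hdec : ∀ x, φ x = φ.linear x + φ 0 := fun x => congrFun (AffineMap.decomp φ) x
  have h0 : IsIntPt (φ 0) := (hi' 0).1 (fun i => ⟨0, by simp⟩)
  have hLi : ∀ x, IsIntPt x ↔ IsIntPt (φ.linear x) := by
    intro x
    rw [hi' x]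
    constructor
    · intro h
      have := h.sub' h0
      rwa [hdec x, add_sub_cancel_right] at this
    · intro h
      rw [hdec x]; exact h.add' h0
  have hLb : Function.Bijective φ.linear := by
    rwa [AffineMap.linear_bijective_iff]
  let e := LinearEquiv.ofBijective φ.linear hLb
  obtain ⟨z1, hz1⟩ := chart_int_det φ.linear (fun x hx => (hLi x).1 hx)
  obtain ⟨z2, hz2⟩ := chart_int_det (e.symm : (Fin n → ℝ) →ₗ[ℝ] (Fin n → ℝ)) (fun x hx => by
    rw [hLi]
    have : φ.linear (e.symm x) = x := e.apply_symm_apply x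
    rwa [LinearEquiv.coe_coe, this])
  have hprod : (z1 : ℝ) * z2 = 1 := by
    rw [← hz1, ← hz2, ← LinearMap.det_comp]
    have : φ.linear ∘ₗ (e.symm : (Fin n → ℝ) →ₗ[ℝ] (Fin n → ℝ)) = LinearMap.id := by
      ext1 x; exact LinearMap.ext (fun y => e.apply_symm_apply _) |> fun h => by
        exact congrArg (fun f => f ∘ₗ _) h
    rw [this, LinearMap.det_id]
  have hz : |(z1 : ℝ)| = 1 := by
    have h1 : z1 * z2 = 1 := by exact_mod_cast hprod
    have : |z1| = 1 := Int.isUnit_iff_abs_eq.1 (IsUnit.of_mul_eq_one _ h1)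
    exact_mod_cast this
  have himg : (fun x => φ x) '' S = (fun x => x + φ 0) '' (φ.linear '' S) := by
    rw [Set.image_image]
    exact Set.image_congr fun x _ => hdec x
  rw [himg, Set.image_add_right, measure_preimage_add_right, Measure.addHaar_image_linearMap,
    hz1, hz]
  simp [Measure.real]

lemma normVol_aux {n r : ℕ} (h : r = n) {S : Set (Fin n → ℝ)} (hS : affineSpan ℝ S = ⊤) :
    (∃ φ : (Fin n → ℝ) →ᵃ[ℝ] (Fin r → ℝ), IsLatticeChart S φ) ∧
    ∀ φ : (Fin n → ℝ) →ᵃ[ℝ] (Fin r → ℝ), IsLatticeChart S φ →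
      (volume ((fun x => φ x) '' S)).toReal = volume.real S := by
  subst h
  refine ⟨⟨AffineMap.id ℝ _, ?_, fun x _ => Iff.rfl⟩, chart_vol hS⟩
  rw [hS]
  exact Set.bijOn_univ.2 Function.bijective_id

lemma polyDim_top {n : ℕ} {S : Set (Fin n → ℝ)} (hS : affineSpan ℝ S = ⊤) : polyDim S = n := by
  rw [polyDim, hS, AffineSubspace.direction_top, finrank_top]; simp

lemma normVol_top {n : ℕ} {S : Set (Fin n → ℝ)} (hS : affineSpan ℝ S = ⊤) :
    normVol S = (n.factorial : ℝ) * volume.real S := by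
  obtain ⟨h1, h2⟩ := normVol_aux (polyDim_top hS) hS
  rw [normVol, dif_pos h1, h2 _ h1.choose_spec, polyDim_top hS]

lemma vol_zero {n : ℕ} {S : Set (Fin n → ℝ)} (hS : affineSpan ℝ S ≠ ⊤) :
    volume.real S = 0 := by
  have := measure_mono_null (subset_affineSpan ℝ S) (Measure.addHaar_affineSubspace volume _ hS)
  simp [Measure.real, this]

lemma self_face {n : ℕ} (P : Set (Fin n → ℝ)) : IsFace P P :=
  Or.inr ⟨0, by ext x; simp [argminSet, dotR]⟩

/-- For `n = 2^k` and `P ∈ Q_k`, the Minkowski sum `P + Δ^n_0` has odd normalized volume;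
in particular it is not in `Q_k`. -/
theorem add_simplex_not_in_Qk (k : ℕ) (P : Set (Fin (2 ^ k) → ℝ)) (hP : InQclass k P) :
    (∃ m : ℤ, normVol (P + stdSimplexPoly (2 ^ k)) = 2 * (m : ℝ) + 1) ∧
    ¬ InQclass k (P + stdSimplexPoly (2 ^ k)) := by

  obtain ⟨hlat, hface⟩ := hP
  obtain ⟨a, v, hv⟩ := latpoly_enum hlat
  obtain ⟨z1, z2, z3, y, h1, h2, h3, hz⟩ := core k _ _ v _ P (stdSimplexPoly (2 ^ k)) hv
    (simplex_eq (2 ^ k))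
  rw [simplex_vol] at h3
  have hz3 : z3 = 1 := by exact_mod_cast h3.symm
  have hz2 : ∃ m, z2 = 2 * m := by
    by_cases hS : affineSpan ℝ P = ⊤
    · obtain ⟨m, hm⟩ := hface P (self_face P) (polyDim_top hS).ge
      rw [normVol_top hS, h2] at hm
      exact ⟨m, by exact_mod_cast hm⟩
    · rw [vol_zero hS, mul_zero] at h2
      exact ⟨0, by simpa using (by exact_mod_cast h2.symm : z2 = 0)⟩
  obtain ⟨m, rfl⟩ := hz2
  have hz1 : z1 = 2 * (m + y) + 1 := by omega
  have hS : affineSpan ℝ (P + stdSimplexPoly (2 ^ k)) = ⊤ := by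
    by_contra hS
    rw [vol_zero hS, mul_zero] at h1
    have : z1 = 0 := by exact_mod_cast h1.symm
    omega
  have hodd : normVol (P + stdSimplexPoly (2 ^ k)) = 2 * ((m + y : ℤ) : ℝ) + 1 := by
    rw [normVol_top hS, h1, hz1]; push_cast; ring
  refine ⟨⟨m + y, hodd⟩, fun hQ => ?_⟩
  obtain ⟨j, hj⟩ := hQ.2 _ (self_face _) (polyDim_top hS).ge
  rw [hodd] at hj
  have : 2 * (m + y) + 1 = 2 * j := by exact_mod_cast hj
  omega

end
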